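/- Let Ω ⊆ ℝ² be open and bounded. Then for every u ∈ W^{2,1}_{Δ,0}(Ω) one has ‖u‖*_{Lexp} ≤ (1/(8π)) ‖Δu‖_{L¹(Ω)}, and the constant 1/(8π) is sharp: it cannot be replaced by any smaller constant. -/

import Mathlib

open MeasureTheory Filter Topology
open scoped ENNReal

noncomputable section

/-- Euclidean space ℝⁿ. -/
abbrev Euc (n : ℕ) := EuclideanSpace ℝ (Fin n)

/-- The (pointwise) Laplacian of a function on ℝⁿ: the trace of the second derivative. -/
def lapl (n : ℕ) (φ : Euc n → ℝ) (x : Euc n) : ℝ :=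
  ∑ i : Fin n,
    iteratedFDeriv ℝ 2 φ x ![EuclideanSpace.single i (1 : ℝ), EuclideanSpace.single i (1 : ℝ)]

/-- A test function on Ω: smooth and compactly supported inside Ω. -/
def IsTestFun (n : ℕ) (Ω : Set (Euc n)) (φ : Euc n → ℝ) : Prop :=
  ContDiff ℝ (⊤ : ℕ∞) φ ∧ HasCompactSupport φ ∧ tsupport φ ⊆ Ω

/-- `u ∈ W₀^{1,1}(Ω)`: `u` is an L¹(Ω) limit of test functions whose gradients converge
in L¹(Ω) (i.e. `u` is in the closure of C_c^∞(Ω) in the W^{1,1} norm). -/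
def MemW0_1_1 (n : ℕ) (Ω : Set (Euc n)) (u : Euc n → ℝ) : Prop :=
  IntegrableOn u Ω volume ∧
  ∃ φ : ℕ → Euc n → ℝ, (∀ k, IsTestFun n Ω (φ k)) ∧
    Tendsto (fun k => ∫ x in Ω, |φ k x - u x|) atTop (𝓝 0) ∧
    ∃ g : Euc n → Euc n →L[ℝ] ℝ,
      IntegrableOn (fun x => ‖g x‖) Ω volume ∧
      Tendsto (fun k => ∫ x in Ω, ‖fderiv ℝ (φ k) x - g x‖) atTop (𝓝 0)

/-- `u ∈ W^{2,1}_Δ(Ω)` with distributional Laplacian `f ∈ L¹(Ω)`. -/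
def MemW21Delta (n : ℕ) (Ω : Set (Euc n)) (u f : Euc n → ℝ) : Prop :=
  MemW0_1_1 n Ω u ∧ IntegrableOn f Ω volume ∧
    ∀ ψ : Euc n → ℝ, IsTestFun n Ω ψ →
      ∫ x in Ω, u x * lapl n ψ x = ∫ x in Ω, f x * ψ x

/-- `u ∈ W^{2,1}_{Δ,0}(Ω)` with Laplacian `f`: `u` is an L¹(Ω) limit of test functions `φ k`
with `Δ(φ k) → f` in L¹(Ω) (closure of C_c^∞(Ω) in the norm ‖Δu‖₁). -/
def MemW21Delta0 (n : ℕ) (Ω : Set (Euc n)) (u f : Euc n → ℝ) : Prop :=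
  IntegrableOn u Ω volume ∧ IntegrableOn f Ω volume ∧
  ∃ φ : ℕ → Euc n → ℝ, (∀ k, IsTestFun n Ω (φ k)) ∧
    Tendsto (fun k => ∫ x in Ω, |φ k x - u x|) atTop (𝓝 0) ∧
    Tendsto (fun k => ∫ x in Ω, |lapl n (φ k) x - f x|) atTop (𝓝 0)

/-- The decreasing rearrangement `u*(t)` of `u` on Ω. -/
def decRearr (n : ℕ) (Ω : Set (Euc n)) (u : Euc n → ℝ) (t : ℝ) : ℝ :=
  sInf {s : ℝ | 0 ≤ s ∧ volume {x ∈ Ω | s < |u x|} ≤ ENNReal.ofReal t}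

/-- `‖f‖_{L¹(Ω)}`. -/
def L1norm (n : ℕ) (Ω : Set (Euc n)) (f : Euc n → ℝ) : ℝ := ∫ x in Ω, |f x|

/-- ω_{n-1}: surface measure of the unit sphere in ℝⁿ. -/
def omegaS (n : ℕ) : ℝ := 2 * Real.pi ^ ((n : ℝ) / 2) / Real.Gamma ((n : ℝ) / 2)

/-- c_n = 1/((n-2) ω_{n-1}). -/
def cConst (n : ℕ) : ℝ := 1 / (((n : ℝ) - 2) * omegaS n)

/-- `N*_V(t)`: the rearrangement of the Green function of the ball of volume V. -/
def NstarV (n : ℕ) (V t : ℝ) : ℝ :=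
  if n = 2 then (1 / (4 * Real.pi)) * Real.log (V / t)
  else cConst n * (omegaS n / (n : ℝ)) ^ (((n : ℝ) - 2) / (n : ℝ)) *
    (t ^ (-(((n : ℝ) - 2) / (n : ℝ))) - V ^ (-(((n : ℝ) - 2) / (n : ℝ))))

/-- `N*_∞(t)` (for n ≥ 3). -/
def NstarInf (n : ℕ) (t : ℝ) : ℝ :=
  cConst n * (omegaS n / (n : ℝ)) ^ (((n : ℝ) - 2) / (n : ℝ)) *
    t ^ (-(((n : ℝ) - 2) / (n : ℝ)))

/-- The maximal function `u**(t) = (1/t) ∫₀ᵗ u*(s) ds`. -/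
def maximalFn (n : ℕ) (Ω : Set (Euc n)) (u : Euc n → ℝ) (t : ℝ) : ℝ :=
  (1 / t) * ∫ s in (0:ℝ)..t, decRearr n Ω u s

/-- `u ∈ L_exp(Ω)`. -/
def MemLexp (n : ℕ) (Ω : Set (Euc n)) (u : Euc n → ℝ) : Prop :=
  ∃ M : ℝ, ∀ t : ℝ, 0 < t → t ≤ (volume Ω).toReal →
    decRearr n Ω u t / (1 + Real.log ((volume Ω).toReal / t)) ≤ M

/-- `u ∈ L_{exp,0}(Ω)`. -/
def MemLexp0 (n : ℕ) (Ω : Set (Euc n)) (u : Euc n → ℝ) : Prop :=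
  MemLexp n Ω u ∧
    Tendsto (fun t : ℝ => maximalFn n Ω u t / Real.log (1 / t)) (𝓝[>] 0) (𝓝 0)

/-- `u ∈ L^{n/(n-2),∞}(Ω)`. -/
def MemWeakL (n : ℕ) (Ω : Set (Euc n)) (u : Euc n → ℝ) : Prop :=
  ∃ M : ℝ, ∀ t : ℝ, 0 < t → t ≤ (volume Ω).toReal →
    t ^ (((n : ℝ) - 2) / (n : ℝ)) * decRearr n Ω u t ≤ M

/-- `u ∈ L₀^{n/(n-2),∞}(Ω)`. -/
def MemWeakL0 (n : ℕ) (Ω : Set (Euc n)) (u : Euc n → ℝ) : Prop :=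
  MemWeakL n Ω u ∧
    Tendsto (fun t : ℝ => t ^ (((n : ℝ) - 2) / (n : ℝ)) * maximalFn n Ω u t) (𝓝[>] 0) (𝓝 0)

/-- `Λ_n^0(Ω)`: equals `L_{exp,0}(Ω)` if n = 2 and `L₀^{n/(n-2),∞}(Ω)` if n ≥ 3. -/
def MemLambda0 (n : ℕ) (Ω : Set (Euc n)) (u : Euc n → ℝ) : Prop :=
  if n = 2 then MemLexp0 n Ω u else MemWeakL0 n Ω u

/-- The Zygmund quasi-norm ‖u‖*_{Lexp} on Ω ⊆ ℝ². -/
def LexpNorm (Omg : Set (Euc 2)) (u : Euc 2 → ℝ) : ℝ :=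
  sSup {r : ℝ | ∃ t : ℝ, 0 < t ∧ t ≤ (volume Omg).toReal ∧
    r = decRearr 2 Omg u t / (1 + Real.log ((volume Omg).toReal / t))}

section

open Set Metric

theorem integral_eq_integral_toSphere_Ioi {F : Euc 2 → ℝ} (hF : Integrable F) :
    ∫ x, F x = ∫ ω, (∫ r in Ioi (0 : ℝ), r * F (r • (ω : Euc 2)))
      ∂((volume : Measure (Euc 2)).toSphere) := by
  have hmp := (volume : Measure (Euc 2)).measurePreserving_homeomorphUnitSphereProd
  have hemb := (homeomorphUnitSphereProd (Euc 2)).measurableEmbedding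
  have hdim : Module.finrank ℝ (Euc 2) - 1 = 1 := by simp
  rw [hdim] at hmp
  set G : sphere (0 : Euc 2) 1 × Ioi (0 : ℝ) → ℝ := fun p => F (p.2.1 • (p.1 : Euc 2)) with hG
  have hGF : ∀ x : ({(0 : Euc 2)}ᶜ : Set (Euc 2)),
      G (homeomorphUnitSphereProd (Euc 2) x) = F x := by
    intro x
    have hx : ‖(x : Euc 2)‖ ≠ 0 := norm_ne_zero_iff.2 x.2
    simp [hG, smul_smul, hx]
  have hGint : Integrable G
      ((volume : Measure (Euc 2)).toSphere.prod (Measure.volumeIoiPow 1)) := by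
    rw [← hmp.integrable_comp_emb hemb]
    have : G ∘ homeomorphUnitSphereProd (Euc 2) = F ∘ Subtype.val := by
      ext x; exact hGF x
    rw [this, ← (MeasurableEmbedding.subtype_coe
      (measurableSet_singleton (0 : Euc 2)).compl).integrable_map_iff,
      map_comap_subtype_coe (measurableSet_singleton (0 : Euc 2)).compl]
    exact hF.integrableOn
  calc ∫ x, F x = ∫ x : ({(0 : Euc 2)}ᶜ : Set (Euc 2)), F x ∂(volume.comap Subtype.val) := by
        rw [integral_subtype_comap (measurableSet_singleton _).compl F,
          restrict_compl_singleton]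
    _ = ∫ p, G p ∂((volume : Measure (Euc 2)).toSphere.prod (Measure.volumeIoiPow 1)) := by
        rw [← hmp.integral_comp hemb]
        exact integral_congr_ae (.of_forall fun x => (hGF x).symm)
    _ = _ := by
        rw [integral_prod _ hGint]
        refine integral_congr_ae (.of_forall fun ω => ?_)
        simp only [Measure.volumeIoiPow, ENNReal.ofReal]
        rw [integral_withDensity_eq_integral_smul
            ((measurable_subtype_coe.pow_const _).real_toNNReal),
          integral_subtype_comap measurableSet_Ioi
            fun a ↦ Real.toNNReal (a ^ 1) • F (a • (ω : Euc 2)),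
          setIntegral_congr_fun measurableSet_Ioi fun x hx ↦ ?_]
        rw [NNReal.smul_def, Real.coe_toNNReal _ (pow_nonneg hx.out.le _), pow_one, smul_eq_mul]

theorem toSphere_real_univ_two :
    ((volume : Measure (Euc 2)).toSphere).real univ = 2 * Real.pi := by
  rw [Measure.toSphere_real_apply_univ]
  simp [measureReal_def, EuclideanSpace.volume_ball_fin_two, Real.pi_nonneg]

theorem sum_apply_mul_sub_two_mul_le {n : ℕ} (a b : Euc n →L[ℝ] ℝ) {ω : Euc n}
    (hω : ω = 0 ∨ ‖ω‖ = 1) :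
    ∑ i, a (EuclideanSpace.single i 1) * b (EuclideanSpace.single i 1) - 2 * (a ω * b ω)
      ≤ ‖a‖ * ‖b‖ := by
  obtain ⟨a, rfl⟩ := (InnerProductSpace.toDual ℝ (Euc n)).surjective a
  obtain ⟨b, rfl⟩ := (InnerProductSpace.toDual ℝ (Euc n)).surjective b
  have hsum : ∑ i, a i * b i = inner ℝ a b := by
    simp [PiLp.inner_apply, mul_comm]
  simp only [InnerProductSpace.toDual_apply_apply, LinearIsometryEquiv.norm_map,
    EuclideanSpace.inner_single_right, one_mul, conj_trivial, hsum]
  have key : inner ℝ a (b - (2 * inner ℝ b ω) • ω) ≤ ‖a‖ * ‖b‖ := by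
    refine (real_inner_le_norm _ _).trans ?_
    gcongr
    rw [← sq_le_sq₀ (norm_nonneg _) (norm_nonneg _), norm_sub_sq_real, inner_smul_right,
      norm_smul, mul_pow, Real.norm_eq_abs, sq_abs]
    rcases hω with rfl | h
    · simp
    · rw [h]; apply le_of_eq; ring
  rw [inner_sub_right, inner_smul_right] at key
  linarith

theorem Continuous.integrable_mul_of_hasCompactSupport {n : ℕ} {a b : Euc n → ℝ}
    (ha : Continuous a) (hb : Continuous b) (hbc : HasCompactSupport b) :
    Integrable (fun x => a x * b x) :=
  (ha.mul hb).integrable_of_hasCompactSupport hbc.mul_left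

theorem HasCompactSupport.fderiv_apply_const {n : ℕ} {a : Euc n → ℝ} (ha : HasCompactSupport a)
    (v : Euc n) : HasCompactSupport (fun x => fderiv ℝ a x v) :=
  (ha.fderiv (𝕜 := ℝ)).comp_left (g := fun L : Euc n →L[ℝ] ℝ => L v) (by simp)

theorem ContDiff.fderiv_apply_const {n : ℕ} {a : Euc n → ℝ} {k m : WithTop ℕ∞}
    (ha : ContDiff ℝ k a) (hk : m + 1 ≤ k) (v : Euc n) :
    ContDiff ℝ m (fun x => fderiv ℝ a x v) :=
  (ha.fderiv_right hk).clm_apply contDiff_const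

theorem hasDerivAt_integral_translate_mul {n : ℕ} {a b : Euc n → ℝ} (ha : ContDiff ℝ 1 a)
    (hac : HasCompactSupport a) (hb : Continuous b) (hbc : HasCompactSupport b)
    (v : Euc n) (r : ℝ) :
    HasDerivAt (fun r : ℝ => ∫ y, a (r • v + y) * b y)
      (∫ y, fderiv ℝ a (r • v + y) v * b y) r := by
  have hD : Continuous (fun x => fderiv ℝ a x v) :=
    (ha.fderiv_apply_const (m := 0) (by norm_num) v).continuous
  obtain ⟨M, hM⟩ := hD.bounded_above_of_compact_support (hac.fderiv_apply_const v)
  refine (hasDerivAt_integral_of_dominated_loc_of_deriv_le (s := univ)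
    (bound := fun y => M * ‖b y‖) (F' := fun r y => fderiv ℝ a (r • v + y) v * b y)
    Filter.univ_mem ?_ ?_ ?_ ?_ ?_ ?_).2
  · refine .of_forall fun x => Continuous.aestronglyMeasurable ?_
    exact (ha.continuous.comp (by fun_prop)).mul hb
  · exact Continuous.integrable_mul_of_hasCompactSupport (ha.continuous.comp (by fun_prop)) hb hbc
  · exact ((hD.comp (by fun_prop : Continuous fun y => r • v + y)).mul hb).aestronglyMeasurable
  · refine .of_forall fun y x _ => ?_
    rw [norm_mul]
    gcongr
    exact hM _
  · exact ((hb.integrable_of_hasCompactSupport hbc).norm).const_mul M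
  · refine .of_forall fun y x _ => ?_
    refine HasDerivAt.mul_const ?_ _
    have h1 : HasDerivAt (fun x : ℝ => x • v + y) v x := by
      simpa using ((hasDerivAt_id x).smul_const v).add_const y
    exact ((ha.differentiable one_ne_zero _).hasFDerivAt).comp_hasDerivAt x h1

theorem integral_Ioi_mul_autocorrelation {n : ℕ} {u : Euc n → ℝ} (hu : ContDiff ℝ 2 u)
    (huc : HasCompactSupport u) {ω : Euc n} (hω : ‖ω‖ = 1) :
    ∫ r in Ioi (0 : ℝ), r * ∫ y, fderiv ℝ u (r • ω + y) ω * fderiv ℝ u y ω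
      = - ∫ y, u y ^ 2 := by
  set a : Euc n → ℝ := fun x => fderiv ℝ u x ω with ha_def
  have ha : ContDiff ℝ 1 a := hu.fderiv_apply_const (by norm_num) ω
  have hac : HasCompactSupport a := huc.fderiv_apply_const ω
  have hu1 : ContDiff ℝ 1 u := hu.of_le (by norm_num)
  have hg := hasDerivAt_integral_translate_mul hu1 huc hu.continuous huc ω
  have hg' := hasDerivAt_integral_translate_mul ha hac hu.continuous huc ω
  have hW := hasDerivAt_integral_translate_mul ha hac ha.continuous hac ω
  have hparts : ∀ r : ℝ, ∫ y, fderiv ℝ a (r • ω + y) ω * u y = - ∫ y, a (r • ω + y) * a y := by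
    intro r
    have hcont : Continuous fun y : Euc n => r • ω + y := by fun_prop
    have hfd : ∀ y, fderiv ℝ (fun y => a (r • ω + y)) y = fderiv ℝ a (r • ω + y) := fun y =>
      fderiv_comp_add_left _
    have := integral_mul_fderiv_eq_neg_fderiv_mul_of_integrable (μ := volume)
      (f := fun y => a (r • ω + y)) (g := u) (v := ω) ?_ ?_ ?_ ?_ ?_
    · simp only [hfd] at this
      linarith
    · simp only [hfd]
      exact Continuous.integrable_mul_of_hasCompactSupport
        (((ha.fderiv_apply_const (m := 0) (by norm_num) ω).continuous).comp hcont) hu.continuous huc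
    · exact Continuous.integrable_mul_of_hasCompactSupport (ha.continuous.comp hcont)
        ha.continuous hac
    · exact Continuous.integrable_mul_of_hasCompactSupport (ha.continuous.comp hcont)
        hu.continuous huc
    · intro x _
      exact (ha.differentiable one_ne_zero _).comp x (by fun_prop)
    · intro x _
      exact hu1.differentiable one_ne_zero x
  obtain ⟨R, hR⟩ : ∃ R : ℝ, ∀ x, R < ‖x‖ → u x = 0 := by
    obtain ⟨R, hR⟩ := huc.isCompact.isBounded.subset_closedBall 0
    refine ⟨R, fun x hx => image_eq_zero_of_notMem_tsupport fun h => ?_⟩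
    have := hR h
    rw [mem_closedBall_zero_iff] at this
    linarith
  have hRa : ∀ x, R < ‖x‖ → a x = 0 := by
    intro x hx
    have : u =ᶠ[𝓝 x] fun _ => 0 := by
      filter_upwards [continuous_norm.continuousAt.eventually (lt_mem_nhds hx)] with y hy
      exact hR y hy
    simp [ha_def, this.fderiv_eq]
  have hfar : ∀ b c : Euc n → ℝ, (∀ x, R < ‖x‖ → b x = 0) → (∀ x, R < ‖x‖ → c x = 0) →
      ∀ r : ℝ, 2 * R < |r| → ∫ y, b (r • ω + y) * c y = 0 := by
    intro b c hb hc r hr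
    rw [integral_eq_zero_of_ae]
    refine .of_forall fun y => ?_
    by_cases hy : R < ‖y‖
    · simp [hc y hy]
    · have : R < ‖r • ω + y‖ := by
        have h1 := norm_sub_le (r • ω + y) y
        rw [add_sub_cancel_right, norm_smul, hω, Real.norm_eq_abs] at h1
        linarith
      simp [hb _ this]
  have hderiv : ∀ r : ℝ, HasDerivAt (fun r : ℝ => (∫ y, u (r • ω + y) * u y)
      - r * ∫ y, a (r • ω + y) * u y) (r * ∫ y, a (r • ω + y) * a y) r := by
    intro r
    refine ((hg r).sub ((hasDerivAt_id r).mul (hg' r))).congr_deriv ?_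
    rw [hparts]
    simp [ha_def]
  have hInt : Integrable (fun r : ℝ => r * ∫ y, a (r • ω + y) * a y) := by
    have hc : Continuous fun r : ℝ => ∫ y, a (r • ω + y) * a y :=
      continuous_iff_continuousAt.2 fun r => (hW r).continuousAt
    refine (continuous_id.mul hc).integrable_of_hasCompactSupport ?_
    refine HasCompactSupport.intro (isCompact_closedBall (0 : ℝ) (2 * R)) fun r hr => ?_
    rw [mem_closedBall_zero_iff, Real.norm_eq_abs, not_le] at hr
    simp [hfar a a hRa hRa r hr]
  have htend : Tendsto (fun r : ℝ => (∫ y, u (r • ω + y) * u y)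
      - r * ∫ y, a (r • ω + y) * u y) atTop (𝓝 0) := by
    refine tendsto_const_nhds.congr' ?_
    filter_upwards [eventually_gt_atTop (2 * R)] with r hr
    have hr' : 2 * R < |r| := hr.trans_le (le_abs_self r)
    simp [hfar u u hR hR r hr', hfar a u hRa hR r hr']
  rw [integral_Ioi_of_hasDerivAt_of_tendsto' (fun r _ => hderiv r) hInt.integrableOn htend]
  simp [sq]

theorem four_pi_mul_integral_sq_le {u : Euc 2 → ℝ} (hu : ContDiff ℝ 2 u)
    (huc : HasCompactSupport u) :
    4 * Real.pi * ∫ x, u x ^ 2 ≤ (∫ x, ‖fderiv ℝ u x‖) ^ 2 := by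
  set D := fderiv ℝ u with hD_def
  have hD : Continuous D := hu.continuous_fderiv (by norm_num)
  have hDc : HasCompactSupport D := huc.fderiv (𝕜 := ℝ)
  have hDn : Integrable (fun x => ‖D x‖) := (hD.integrable_of_hasCompactSupport hDc).norm
  set dir : Euc 2 → Euc 2 := fun z => ‖z‖⁻¹ • z with hdir_def
  have hdir : Measurable dir := measurable_norm.inv.smul measurable_id
  have hdir1 : ∀ z, dir z = 0 ∨ ‖dir z‖ = 1 := by
    intro z
    by_cases hz : z = 0
    · left; simp [hdir_def, hz]
    · right; simp [hdir_def, norm_smul, hz]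
  set K : Euc 2 × Euc 2 → ℝ := fun p => D p.1 (dir (p.1 - p.2)) * D p.2 (dir (p.1 - p.2))
    with hK_def
  have happ : Measurable (fun p : Euc 2 × Euc 2 => D p.1 p.2) :=
    ((hD.comp continuous_fst).clm_apply continuous_snd).measurable
  have hKm : Measurable K := by
    have hd : Measurable fun p : Euc 2 × Euc 2 => dir (p.1 - p.2) :=
      hdir.comp (measurable_fst.sub measurable_snd)
    exact (happ.comp (measurable_fst.prodMk hd)).mul (happ.comp (measurable_snd.prodMk hd))
  have hprod : Integrable (fun p : Euc 2 × Euc 2 => ‖D p.1‖ * ‖D p.2‖)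
      (volume.prod volume) := hDn.mul_prod hDn
  have hdle : ∀ (L : Euc 2 →L[ℝ] ℝ) z, ‖L (dir z)‖ ≤ ‖L‖ := by
    intro L z
    refine (L.le_opNorm _).trans (mul_le_of_le_one_right (norm_nonneg _) ?_)
    rcases hdir1 z with h | h <;> simp [h]
  have hKint : Integrable K (volume.prod volume) := by
    refine hprod.mono' hKm.aestronglyMeasurable (.of_forall fun p => ?_)
    rw [hK_def, norm_mul]
    gcongr <;> exact hdle _ _
  have hDi : ∀ i : Fin 2, Integrable (fun x => D x (EuclideanSpace.single i 1)) := fun i =>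
    ((hu.fderiv_apply_const (m := 1) (by norm_num) _).continuous).integrable_of_hasCompactSupport
      (huc.fderiv_apply_const _)
  have hDi0 : ∀ i : Fin 2, ∫ x, D x (EuclideanSpace.single i 1) = 0 := by
    intro i
    have hu1 : Differentiable ℝ u := hu.differentiable (by norm_num)
    have := integral_mul_fderiv_eq_neg_fderiv_mul_of_integrable (μ := volume)
      (f := fun _ : Euc 2 => (1 : ℝ)) (g := u) (v := EuclideanSpace.single i 1)
      (by simp) (by simpa using hDi i)
      (by simpa using hu.continuous.integrable_of_hasCompactSupport huc)
      (by simp) (fun x _ => hu1 x)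
    simpa using this
  have hle : -2 * ∫ p, K p ∂(volume.prod volume) ≤ (∫ x, ‖D x‖) ^ 2 := by
    have h1 : ∫ p : Euc 2 × Euc 2, (∑ i : Fin 2, D p.1 (EuclideanSpace.single i 1) *
        D p.2 (EuclideanSpace.single i 1) - 2 * K p) ∂(volume.prod volume)
        ≤ ∫ p : Euc 2 × Euc 2, ‖D p.1‖ * ‖D p.2‖ ∂(volume.prod volume) := by
      refine integral_mono ?_ hprod fun p => ?_
      · exact (integrable_finsetSum _ fun i _ => (hDi i).mul_prod (hDi i)).sub (hKint.const_mul 2)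
      · exact sum_apply_mul_sub_two_mul_le _ _ (hdir1 _)
    rw [integral_sub (integrable_finsetSum _ fun i _ => (hDi i).mul_prod (hDi i))
      (hKint.const_mul 2), integral_finsetSum _ (fun i _ => (hDi i).mul_prod (hDi i)),
      integral_const_mul, integral_prod_mul (fun x => ‖D x‖) (fun x => ‖D x‖)] at h1
    have h0 : ∀ i : Fin 2, ∫ p : Euc 2 × Euc 2, D p.1 (EuclideanSpace.single i 1) *
        D p.2 (EuclideanSpace.single i 1) ∂(volume.prod volume) = 0 := by
      intro i
      rw [integral_prod_mul (fun x => D x (EuclideanSpace.single i 1))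
        (fun x => D x (EuclideanSpace.single i 1)), hDi0, zero_mul]
    rw [Finset.sum_eq_zero fun i _ => h0 i] at h1
    linarith
  have hmp := measurePreserving_add_prod (volume : Measure (Euc 2)) (volume : Measure (Euc 2))
  set K' : Euc 2 × Euc 2 → ℝ := fun p => D (p.1 + p.2) (dir p.1) * D p.2 (dir p.1) with hK'_def
  have hKK' : ∀ p : Euc 2 × Euc 2, K (p.1 + p.2, p.2) = K' p := by
    intro p; simp [hK_def, hK'_def]
  have hK'int : Integrable K' (volume.prod volume) := by
    have := hmp.integrable_comp_of_integrable hKint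
    exact this.congr (.of_forall hKK')
  have hpolar : ∫ p, K p ∂(volume.prod volume) = -(2 * Real.pi) * ∫ x, u x ^ 2 := by
    calc ∫ p, K p ∂(volume.prod volume) = ∫ p, K' p ∂(volume.prod volume) := by
          conv_lhs => rw [← hmp.map_eq]
          rw [integral_map hmp.measurable.aemeasurable hKm.aestronglyMeasurable]
          exact integral_congr_ae (.of_forall hKK')
      _ = ∫ z, ∫ y, K' (z, y) := integral_prod _ hK'int
      _ = ∫ _ω, (-∫ x, u x ^ 2) ∂((volume : Measure (Euc 2)).toSphere) := by
          rw [integral_eq_integral_toSphere_Ioi hK'int.integral_prod_left]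
          refine integral_congr_ae (.of_forall fun ω => ?_)
          have hω : ‖(ω : Euc 2)‖ = 1 := by simp
          dsimp only
          rw [← integral_Ioi_mul_autocorrelation hu huc hω]
          refine setIntegral_congr_fun measurableSet_Ioi fun r hr => ?_
          have hr' : (0 : ℝ) < r := hr
          have : dir (r • (ω : Euc 2)) = ω := by
            simp only [hdir_def, norm_smul, hω, Real.norm_eq_abs, abs_of_pos hr', mul_one,
              smul_smul, inv_mul_cancel₀ hr'.ne', one_smul]
          simp [hK'_def, this, hD_def]
      _ = _ := by
          rw [integral_const, toSphere_real_univ_two, smul_eq_mul]; ring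
  rw [hpolar] at hle
  linarith

theorem lapl_eq_sum_fderiv {n : ℕ} {φ : Euc n → ℝ} (hφ : ContDiff ℝ 2 φ) (x : Euc n) :
    lapl n φ x = ∑ i : Fin n, fderiv ℝ (fun y => fderiv ℝ φ y (EuclideanSpace.single i 1)) x
      (EuclideanSpace.single i 1) := by
  unfold lapl
  refine Finset.sum_congr rfl fun i _ => ?_
  have hd : DifferentiableAt ℝ (fderiv ℝ φ) x :=
    (hφ.fderiv_right (m := 1) (by norm_num)).differentiable one_ne_zero x
  rw [iteratedFDeriv_two_apply, fderiv_clm_apply hd (differentiableAt_const _)]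
  simp

theorem sum_apply_single_sq {n : ℕ} (a : Euc n →L[ℝ] ℝ) :
    ∑ i, a (EuclideanSpace.single i 1) ^ 2 = ‖a‖ ^ 2 := by
  obtain ⟨a, rfl⟩ := (InnerProductSpace.toDual ℝ (Euc n)).surjective a
  simp [EuclideanSpace.norm_sq_eq, EuclideanSpace.inner_single_right]

theorem continuous_lapl {n : ℕ} {φ : Euc n → ℝ} (hφ : ContDiff ℝ 2 φ) :
    Continuous (lapl n φ) := by
  rw [funext (lapl_eq_sum_fderiv hφ)]
  refine continuous_finsetSum _ fun i _ => ?_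
  exact ((hφ.fderiv_apply_const (m := 1) (by norm_num) _).fderiv_apply_const (m := 0)
    (by norm_num) _).continuous

theorem lapl_eq_zero_of_notMem_tsupport {n : ℕ} {φ : Euc n → ℝ} {x : Euc n}
    (hx : x ∉ tsupport φ) : lapl n φ x = 0 := by
  unfold lapl
  refine Finset.sum_eq_zero fun i _ => ?_
  have : iteratedFDeriv ℝ 2 φ x = 0 :=
    image_eq_zero_of_notMem_tsupport fun h => hx (tsupport_iteratedFDeriv_subset 2 h)
  simp [this]

theorem hasCompactSupport_lapl {n : ℕ} {φ : Euc n → ℝ} (hφ : HasCompactSupport φ) :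
    HasCompactSupport (lapl n φ) :=
  HasCompactSupport.intro hφ.isCompact fun _ hx => lapl_eq_zero_of_notMem_tsupport hx

theorem integral_deriv_comp_mul_norm_fderiv_sq {n : ℕ} {φ : Euc n → ℝ} (hφ : ContDiff ℝ 2 φ)
    (hφc : HasCompactSupport φ) {θ : ℝ → ℝ} (hθ : ContDiff ℝ 1 θ) :
    ∫ x, deriv θ (φ x) * ‖fderiv ℝ φ x‖ ^ 2 = - ∫ x, lapl n φ x * θ (φ x) := by
  have hφd : Differentiable ℝ φ := hφ.differentiable (by norm_num)
  have hθd : Differentiable ℝ θ := hθ.differentiable one_ne_zero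
  set p : Fin n → Euc n → ℝ := fun i x => fderiv ℝ φ x (EuclideanSpace.single i 1) with hp
  have hpC : ∀ i, ContDiff ℝ 1 (p i) := fun i => hφ.fderiv_apply_const (by norm_num) _
  have hpc : ∀ i, HasCompactSupport (p i) := fun i => hφc.fderiv_apply_const _
  have hcomp : ∀ x (v : Euc n), fderiv ℝ (fun x => θ (φ x)) x v =
      deriv θ (φ x) * fderiv ℝ φ x v := by
    intro x v
    have h := (hθd (φ x)).hasDerivAt.comp_hasFDerivAt x (hφd x).hasFDerivAt
    rw [show (fun x => θ (φ x)) = θ ∘ φ from rfl, h.fderiv]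
    simp
  have hθφ : Continuous fun x => θ (φ x) := hθ.continuous.comp hφ.continuous
  have hθ'φ : Continuous fun x => deriv θ (φ x) :=
    (hθ.continuous_deriv le_rfl).comp hφ.continuous
  have hi1 : ∀ i, Integrable fun x => fderiv ℝ (p i) x (EuclideanSpace.single i 1) * θ (φ x) := by
    intro i
    have := Continuous.integrable_mul_of_hasCompactSupport hθφ
      (((hpC i).fderiv_apply_const (m := 0) (by norm_num) (EuclideanSpace.single i 1)).continuous)
      ((hpc i).fderiv_apply_const _)
    simpa only [mul_comm] using this
  have hi2 : ∀ i, Integrable fun x => deriv θ (φ x) * p i x ^ 2 := by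
    intro i
    have := Continuous.integrable_mul_of_hasCompactSupport (hθ'φ.mul (hpC i).continuous)
      (hpC i).continuous (hpc i)
    simpa only [sq, mul_assoc, Pi.mul_apply] using this
  have hparts : ∀ i, ∫ x, deriv θ (φ x) * p i x ^ 2
      = - ∫ x, fderiv ℝ (p i) x (EuclideanSpace.single i 1) * θ (φ x) := by
    intro i
    have := integral_mul_fderiv_eq_neg_fderiv_mul_of_integrable (μ := volume)
      (f := p i) (g := fun x => θ (φ x)) (v := EuclideanSpace.single i 1) (hi1 i) ?_ ?_
      (fun x _ => (hpC i).differentiable one_ne_zero x)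
      (fun x _ => (hθd (φ x)).comp x (hφd x))
    · rw [← this]
      refine integral_congr_ae (.of_forall fun x => ?_)
      simp only [hcomp, hp]
      ring
    · refine (hi2 i).congr (.of_forall fun x => ?_)
      simp only [hcomp, hp]
      ring
    · have := Continuous.integrable_mul_of_hasCompactSupport hθφ (hpC i).continuous (hpc i)
      simpa only [mul_comm] using this
  calc ∫ x, deriv θ (φ x) * ‖fderiv ℝ φ x‖ ^ 2
      = ∫ x, ∑ i, deriv θ (φ x) * p i x ^ 2 := by
        refine integral_congr_ae (.of_forall fun x => ?_)
        simp only [← sum_apply_single_sq, Finset.mul_sum, hp]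
    _ = - ∑ i, ∫ x, fderiv ℝ (p i) x (EuclideanSpace.single i 1) * θ (φ x) := by
        rw [integral_finsetSum _ fun i _ => hi2 i, ← Finset.sum_neg_distrib]
        exact Finset.sum_congr rfl fun i _ => hparts i
    _ = _ := by
        rw [← integral_finsetSum _ fun i _ => hi1 i]
        congr 1
        refine integral_congr_ae (.of_forall fun x => ?_)
        simp only [lapl_eq_sum_fderiv hφ, Finset.sum_mul, hp]

theorem exists_smooth_step (s : ℝ) {k h : ℝ} (hk : 0 < k) (hkh : k < h) :
    ∃ (θ : ℝ → ℝ) (K : ℝ), ContDiff ℝ 2 θ ∧ k ≤ K ∧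
      (∀ τ, 0 ≤ θ τ) ∧ (∀ τ, θ τ ≤ K) ∧ (∀ τ, τ ≤ s → θ τ = 0) ∧ (∀ τ, s + h ≤ τ → θ τ = K) ∧
      (∀ τ, 0 ≤ deriv θ τ) ∧ (∀ τ, deriv θ τ ≤ 1) ∧ (∀ τ, τ ≤ s → deriv θ τ = 0) ∧
      (∀ τ, s + h ≤ τ → deriv θ τ = 0) := by
  let f : ContDiffBump (s + h / 2) := ⟨k / 2, h / 2, by linarith, by linarith⟩
  have hfc : Continuous f := f.continuous
  have hfi : ∀ a b, IntervalIntegrable f volume a b := fun a b => hfc.intervalIntegrable a b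
  have hd : ∀ τ, HasDerivAt (fun τ => ∫ x in s..τ, f x) (f τ) τ := fun τ =>
    intervalIntegral.integral_hasDerivAt_right (hfi _ _)
      (hfc.stronglyMeasurableAtFilter _ _) hfc.continuousAt
  have hderiv : deriv (fun τ => ∫ x in s..τ, f x) = f := funext fun τ => (hd τ).deriv
  have hzero : ∀ x, x ≤ s ∨ s + h ≤ x → f x = 0 := by
    intro x hx
    refine f.zero_of_le_dist ?_
    rw [Real.dist_eq, le_abs]
    change h / 2 ≤ _ ∨ h / 2 ≤ _
    rcases hx with hx | hx
    · right; linarith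
    · left; linarith
  have hlow : ∀ τ, τ ≤ s → ∫ x in s..τ, f x = 0 := by
    intro τ hτ
    rw [intervalIntegral.integral_symm, intervalIntegral.integral_congr (g := fun _ => 0)]
    · simp
    · intro x hx
      rw [uIcc_of_le hτ] at hx
      exact hzero x (Or.inl hx.2)
  have hhigh : ∀ τ, s + h ≤ τ → ∫ x in s..τ, f x = ∫ x in s..(s + h), f x := by
    intro τ hτ
    rw [← intervalIntegral.integral_add_adjacent_intervals (hfi s (s + h)) (hfi (s + h) τ),
      intervalIntegral.integral_congr (a := s + h) (g := fun _ => 0)]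
    · simp
    · intro x hx
      rw [uIcc_of_le hτ] at hx
      exact hzero x (Or.inr hx.1)
  have hmono : Monotone fun τ => ∫ x in s..τ, f x :=
    monotone_of_deriv_nonneg (fun τ => (hd τ).differentiableAt) fun τ => by
      rw [hderiv]; exact f.nonneg
  refine ⟨fun τ => ∫ x in s..τ, f x, ∫ x in s..(s + h), f x, ?_, ?_, fun τ => ?_, fun τ => ?_,
    hlow, hhigh, fun τ => ?_, fun τ => ?_, fun τ hτ => ?_, fun τ hτ => ?_⟩
  · rw [show (2 : WithTop ℕ∞) = 1 + 1 by norm_num, contDiff_succ_iff_deriv]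
    refine ⟨fun τ => (hd τ).differentiableAt, by simp, ?_⟩
    rw [hderiv]
    exact f.contDiff
  · have h1 : ∫ x in (s + h / 2 - k / 2)..(s + h / 2 + k / 2), f x = k := by
      rw [intervalIntegral.integral_congr (g := fun _ => 1)]
      · simp
      · intro x hx
        rw [uIcc_of_le (by linarith)] at hx
        refine f.one_of_mem_closedBall ?_
        rw [mem_closedBall, Real.dist_eq, abs_le]
        change -(k / 2) ≤ _ ∧ _ ≤ k / 2
        constructor <;> linarith [hx.1, hx.2]
    calc k = ∫ x in (s + h / 2 - k / 2)..(s + h / 2 + k / 2), f x := h1.symm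
      _ ≤ _ := intervalIntegral.integral_mono_interval (by linarith) (by linarith) (by linarith)
        (.of_forall fun x => f.nonneg) (hfi _ _)
  · rcases le_total τ s with h' | h'
    · exact (hlow τ h').ge
    · exact intervalIntegral.integral_nonneg h' fun x _ => f.nonneg
  · rcases le_total τ (s + h) with h' | h'
    · exact hmono h'
    · exact (hhigh τ h').le
  · rw [hderiv]; exact f.nonneg
  · rw [hderiv]; exact f.le_one
  · rw [hderiv]; exact hzero τ (Or.inl hτ)
  · rw [hderiv]; exact hzero τ (Or.inr hτ)

theorem sq_integral_mul_le {α : Type*} [MeasurableSpace α] {μ : Measure α} {w g : α → ℝ}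
    (hw : ∀ x, 0 ≤ w x) (hw0 : Integrable w μ) (hw1 : Integrable (fun x => w x * g x) μ)
    (hw2 : Integrable (fun x => w x * g x ^ 2) μ) :
    (∫ x, w x * g x ∂μ) ^ 2 ≤ (∫ x, w x * g x ^ 2 ∂μ) * ∫ x, w x ∂μ := by
  have h : ∀ l : ℝ, 0 ≤ (∫ x, w x * g x ^ 2 ∂μ) * (l * l) + (-2 * ∫ x, w x * g x ∂μ) * l
      + ∫ x, w x ∂μ := by
    intro l
    have h0 : 0 ≤ ∫ x, w x * (l * g x - 1) ^ 2 ∂μ :=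
      integral_nonneg fun x => mul_nonneg (hw x) (sq_nonneg _)
    have h1 : ∫ x, w x * (l * g x - 1) ^ 2 ∂μ
        = ∫ x, (l * l) * (w x * g x ^ 2) + (-2 * l) * (w x * g x) + w x ∂μ := by
      congr 1; ext x; ring
    have h2 : Integrable (fun x => l * l * (w x * g x ^ 2) + -2 * l * (w x * g x)) μ :=
      (hw2.const_mul _).add (hw1.const_mul _)
    rw [h1, integral_add h2 hw0, integral_add (hw2.const_mul _) (hw1.const_mul _),
      integral_const_mul, integral_const_mul] at h0
    linarith
  have := discrim_le_zero h
  unfold discrim at this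
  linarith

theorem measure_superlevel_ne_top {n : ℕ} {φ : Euc n → ℝ} (hφc : HasCompactSupport φ) {s : ℝ}
    (hs : 0 ≤ s) : volume {x | s < φ x} ≠ ∞ := by
  refine ((measure_mono fun x (hx : s < φ x) => ?_).trans_lt hφc.isCompact.measure_lt_top).ne
  exact subset_tsupport _ (Function.mem_support.2 (hs.trans_lt hx).ne')

theorem integral_comp_le_measure_superlevel_sub {n : ℕ} {φ : Euc n → ℝ} (hφ : Continuous φ)
    {s t : ℝ} (hst : s ≤ t) (hs : volume {x | s < φ x} ≠ ∞) {w : ℝ → ℝ}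
    (hw : Integrable fun x => w (φ x)) (hw1 : ∀ τ, w τ ≤ 1) (hlow : ∀ τ, τ ≤ s → w τ = 0)
    (hhigh : ∀ τ, t ≤ τ → w τ = 0) :
    ∫ x, w (φ x) ≤ volume.real {x | s < φ x} - volume.real {x | t < φ x} := by
  have hS : MeasurableSet {x | s < φ x} := measurableSet_lt measurable_const hφ.measurable
  have hT : MeasurableSet {x | t < φ x} := measurableSet_lt measurable_const hφ.measurable
  have hTS : {x | t < φ x} ⊆ {x | s < φ x} := fun x hx => hst.trans_lt hx
  rw [← measureReal_sdiff hTS hT hs,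
    ← integral_indicator_one (hS.diff hT)]
  refine integral_mono hw ((integrable_indicator_iff (hS.diff hT)).2 (integrableOn_const
    (ne_top_of_le_ne_top hs (measure_mono sdiff_subset)))) fun x => ?_
  dsimp only
  by_cases hx : x ∈ {x | s < φ x} \ {x | t < φ x}
  · rw [indicator_of_mem hx]
    exact hw1 _
  · rw [indicator_of_notMem hx]
    by_cases hxs : s < φ x
    · have hxt : t < φ x := by_contra fun h => hx ⟨hxs, h⟩
      exact (hhigh _ hxt.le).le
    · exact (hlow _ (not_lt.1 hxs)).le

theorem mul_measure_superlevel_le_integral {n : ℕ} {φ v : Euc n → ℝ} (hφ : Continuous φ)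
    {t c : ℝ} (hv : Integrable v) (hv0 : ∀ x, 0 ≤ v x) (h : ∀ x, t < φ x → c ≤ v x)
    (ht : volume {x | t < φ x} ≠ ∞) :
    c * volume.real {x | t < φ x} ≤ ∫ x, v x := by
  have hT : MeasurableSet {x | t < φ x} := measurableSet_lt measurable_const hφ.measurable
  calc c * volume.real {x | t < φ x} = ∫ _ in {x | t < φ x}, c := by
        rw [setIntegral_const, smul_eq_mul, mul_comm]
    _ ≤ ∫ x in {x | t < φ x}, v x :=
        setIntegral_mono_on (integrableOn_const ht) hv.integrableOn hT h
    _ ≤ ∫ x, v x := setIntegral_le_integral hv (.of_forall hv0)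

theorem integral_deriv_comp_mul_norm_fderiv_sq_le {n : ℕ} {φ : Euc n → ℝ} (hφ : ContDiff ℝ 2 φ)
    (hφc : HasCompactSupport φ) {θ : ℝ → ℝ} (hθ : ContDiff ℝ 1 θ) {K : ℝ} (hθ0 : ∀ τ, 0 ≤ θ τ)
    (hθK : ∀ τ, θ τ ≤ K) :
    ∫ x, deriv θ (φ x) * ‖fderiv ℝ φ x‖ ^ 2 ≤ K / 2 * ∫ x, |lapl n φ x| := by
  have hg := integral_deriv_comp_mul_norm_fderiv_sq hφ hφc
    (θ := fun τ => θ τ - K / 2) (hθ.sub contDiff_const)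
  simp only [deriv_sub_const] at hg
  rw [hg, ← integral_const_mul, ← integral_neg]
  have hL := continuous_lapl hφ
  have hLc := hasCompactSupport_lapl hφc
  refine integral_mono ?_ ?_ fun x => ?_
  · exact ((hL.mul ((hθ.continuous.comp hφ.continuous).sub
      continuous_const)).integrable_of_hasCompactSupport hLc.mul_right).neg
  · exact ((hL.integrable_of_hasCompactSupport hLc).abs).const_mul _
  · dsimp only
    have h1 : |θ (φ x) - K / 2| ≤ K / 2 := by
      rw [abs_le]; constructor <;> linarith [hθ0 (φ x), hθK (φ x)]
    calc -(lapl n φ x * (θ (φ x) - K / 2)) ≤ |lapl n φ x * (θ (φ x) - K / 2)| := neg_le_abs _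
      _ = |lapl n φ x| * |θ (φ x) - K / 2| := abs_mul _ _
      _ ≤ |lapl n φ x| * (K / 2) := by gcongr
      _ = _ := mul_comm _ _

theorem eight_pi_mul_measure_superlevel_le {φ : Euc 2 → ℝ} (hφ : ContDiff ℝ 2 φ)
    (hφc : HasCompactSupport φ) {s h : ℝ} (hs : 0 ≤ s) (hh : 0 < h) :
    8 * Real.pi * h * volume.real {x | s + h < φ x} ≤
      (∫ x, |lapl 2 φ x|) * (volume.real {x | s < φ x} - volume.real {x | s + h < φ x}) := by
  set N := ∫ x, |lapl 2 φ x| with hN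
  set m := volume.real {x | s + h < φ x} with hm
  set M := volume.real {x | s < φ x} with hM
  have hN0 : 0 ≤ N := integral_nonneg fun x => abs_nonneg _
  suffices H : ∀ k, 0 < k → k < h → 8 * Real.pi * k * m ≤ N * (M - m) by
    have hlim : Tendsto (fun k : ℝ => 8 * Real.pi * k * m) (𝓝[<] h) (𝓝 (8 * Real.pi * h * m)) :=
      (Continuous.tendsto (by fun_prop) h).mono_left nhdsWithin_le_nhds
    refine le_of_tendsto hlim ?_
    filter_upwards [Ioo_mem_nhdsLT hh] with k hk
    exact H k hk.1 hk.2
  intro k hk hkh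
  obtain ⟨θ, K, hθ, hkK, hθ0, hθK, hθlow, hθhigh, hθ'0, hθ'1, hθ'low, hθ'high⟩ :=
    exists_smooth_step s hk hkh
  have hK : 0 < K := hk.trans_le hkK
  have hθ1 : ContDiff ℝ 1 θ := hθ.of_le (by norm_num)
  have hθd : Differentiable ℝ θ := hθ1.differentiable one_ne_zero
  have hφd : Differentiable ℝ φ := hφ.differentiable (by norm_num)
  have hSfin := measure_superlevel_ne_top hφc hs
  have hTfin := measure_superlevel_ne_top hφc (add_nonneg hs hh.le)
  have huC : ContDiff ℝ 2 (fun x => θ (φ x)) := hθ.comp hφ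
  have huc : HasCompactSupport (fun x => θ (φ x)) := hφc.comp_left (hθlow 0 hs)
  have hwc : HasCompactSupport (fun x => deriv θ (φ x)) := hφc.comp_left (hθ'low 0 hs)
  have hw : Continuous (fun x => deriv θ (φ x)) :=
    (hθ1.continuous_deriv le_rfl).comp hφ.continuous
  have hgn : Continuous fun x => ‖fderiv ℝ φ x‖ := (hφ.continuous_fderiv (by norm_num)).norm
  have hw0 : Integrable (fun x => deriv θ (φ x)) := hw.integrable_of_hasCompactSupport hwc
  have hgrad : ∀ x, ‖fderiv ℝ (fun x => θ (φ x)) x‖ = deriv θ (φ x) * ‖fderiv ℝ φ x‖ := by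
    intro x
    have h := (hθd (φ x)).hasDerivAt.comp_hasFDerivAt x (hφd x).hasFDerivAt
    rw [show (fun x => θ (φ x)) = θ ∘ φ from rfl, h.fderiv, norm_smul, Real.norm_of_nonneg (hθ'0 _)]
  have hsob := four_pi_mul_integral_sq_le huC huc
  simp only [hgrad] at hsob
  have hcs := sq_integral_mul_le (μ := (volume : Measure (Euc 2))) (fun x => hθ'0 (φ x)) hw0
    ((hw.mul hgn).integrable_of_hasCompactSupport hwc.mul_right)
    ((hw.mul (hgn.pow 2)).integrable_of_hasCompactSupport hwc.mul_right)
  have henergy : ∫ x, deriv θ (φ x) * ‖fderiv ℝ φ x‖ ^ 2 ≤ K / 2 * N :=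
    integral_deriv_comp_mul_norm_fderiv_sq_le hφ hφc hθ1 hθ0 hθK
  have hshell : ∫ x, deriv θ (φ x) ≤ M - m :=
    integral_comp_le_measure_superlevel_sub hφ.continuous (by linarith) hSfin hw0 hθ'1 hθ'low
      hθ'high
  have hlower : K ^ 2 * m ≤ ∫ x, θ (φ x) ^ 2 := by
    have hsq : HasCompactSupport fun x => θ (φ x) ^ 2 :=
      hφc.comp_left (g := fun t => θ t ^ 2) (by simp [hθlow 0 hs])
    have hsqC : Continuous fun x => θ (φ x) ^ 2 := huC.continuous.pow 2
    exact mul_measure_superlevel_le_integral hφ.continuous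
      (hsqC.integrable_of_hasCompactSupport hsq) (fun x => sq_nonneg _)
      (fun x hx => by rw [hθhigh _ (le_of_lt hx)]) hTfin
  have hQ0 : 0 ≤ ∫ x, deriv θ (φ x) := integral_nonneg fun x => hθ'0 _
  have hm0 : 0 ≤ m := measureReal_nonneg
  have hchain : 4 * Real.pi * (K ^ 2 * m) ≤ (K / 2 * N) * (M - m) :=
    calc 4 * Real.pi * (K ^ 2 * m) ≤ 4 * Real.pi * ∫ x, θ (φ x) ^ 2 := by gcongr
      _ ≤ _ := hsob
      _ ≤ _ := hcs
      _ ≤ _ := mul_le_mul henergy hshell hQ0 (by positivity)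
  have h2 : 8 * Real.pi * K * m ≤ N * (M - m) := by
    refine le_of_mul_le_mul_left ?_ (half_pos hK)
    nlinarith [hchain]
  refine le_trans ?_ h2
  gcongr

theorem measure_superlevel_le_exp {Ω : Set (Euc 2)} {φ : Euc 2 → ℝ} (hφ : IsTestFun 2 Ω φ)
    (hΩ : volume Ω ≠ ∞) {A : ℝ} (hA : 0 < A) (hN : ∫ x, |lapl 2 φ x| ≤ 8 * Real.pi * A)
    {s : ℝ} (hs : 0 ≤ s) :
    volume.real {x | s < φ x} ≤ Real.exp (-(s / A)) * volume.real Ω := by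
  obtain ⟨hC, hc, hsub⟩ := hφ
  have hC2 : ContDiff ℝ 2 φ := contDiff_infty.1 hC 2
  set μ : ℝ → ℝ := fun s => volume.real {x | s < φ x} with hμ
  have hμ0 : ∀ s, 0 ≤ μ s := fun s => measureReal_nonneg
  have hμΩ : μ 0 ≤ volume.real Ω := by
    refine measureReal_mono (fun x hx => hsub ?_) hΩ
    exact subset_tsupport _ (Function.mem_support.2 (ne_of_gt hx))
  have hstep : ∀ s h, 0 ≤ s → 0 < h → μ (s + h) * (1 + h / A) ≤ μ s := by
    intro s h hs hh
    have h1 := eight_pi_mul_measure_superlevel_le hC2 hc hs hh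
    have hmono : μ (s + h) ≤ μ s :=
      measureReal_mono (fun x (hx : s + h < φ x) => show s < φ x by linarith)
        (measure_superlevel_ne_top hc hs)
    have h2 : 8 * Real.pi * (h * μ (s + h)) ≤ 8 * Real.pi * (A * (μ s - μ (s + h))) := by
      have := mul_le_mul_of_nonneg_right hN (sub_nonneg.2 hmono)
      simp only [hμ] at this ⊢
      linarith
    have h3 := le_of_mul_le_mul_left h2 (by positivity)
    have h4 : μ (s + h) * (1 + h / A) = (A * μ (s + h) + h * μ (s + h)) / A := by
      field_simp
    rw [h4, div_le_iff₀ hA]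
    linarith
  have hiter : ∀ h, 0 < h → ∀ n : ℕ, μ (n * h) * (1 + h / A) ^ n ≤ μ 0 := by
    intro h hh n
    induction n with
    | zero => simp
    | succ n ih =>
      refine le_trans ?_ ih
      have := hstep (n * h) h (by positivity) hh
      rw [pow_succ']
      push_cast
      rw [← mul_assoc, add_mul, one_mul]
      gcongr
  rcases hs.eq_or_lt with rfl | hs
  · simpa using hμΩ
  have hlim : Tendsto (fun n : ℕ => μ s * (1 + s / A / n) ^ n) atTop
      (𝓝 (μ s * Real.exp (s / A))) := (Real.tendsto_one_add_div_pow_exp (s / A)).const_mul _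
  have hbound : μ s * Real.exp (s / A) ≤ volume.real Ω := by
    refine le_of_tendsto hlim ?_
    filter_upwards [eventually_gt_atTop 0] with n hn
    have hn' : (0 : ℝ) < n := by exact_mod_cast hn
    have := hiter (s / n) (by positivity) n
    rw [mul_div_cancel₀ _ hn'.ne', div_right_comm] at this
    exact this.trans hμΩ
  rw [Real.exp_neg, inv_mul_eq_div, le_div_iff₀ (Real.exp_pos _)]
  exact hbound

theorem IsTestFun.neg {n : ℕ} {Ω : Set (Euc n)} {φ : Euc n → ℝ} (hφ : IsTestFun n Ω φ) :
    IsTestFun n Ω (-φ) :=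
  ⟨hφ.1.neg, hφ.2.1.neg, by rw [tsupport_neg]; exact hφ.2.2⟩

theorem lapl_neg {n : ℕ} (φ : Euc n → ℝ) (x : Euc n) : lapl n (-φ) x = - lapl n φ x := by
  simp [lapl, iteratedFDeriv_neg_apply]

theorem measure_abs_superlevel_le_exp {Ω : Set (Euc 2)} {φ : Euc 2 → ℝ} (hφ : IsTestFun 2 Ω φ)
    (hΩ : volume Ω ≠ ∞) {A : ℝ} (hA : 0 < A) (hN : ∫ x, |lapl 2 φ x| ≤ 8 * Real.pi * A)
    {s : ℝ} (hs : 0 ≤ s) :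
    volume.real {x | s < |φ x|} ≤ 2 * Real.exp (-(s / A)) * volume.real Ω := by
  have h1 := measure_superlevel_le_exp hφ hΩ hA hN hs
  have h2 := measure_superlevel_le_exp hφ.neg hΩ hA (by simpa only [lapl_neg, abs_neg] using hN) hs
  have hunion : {x | s < |φ x|} = {x | s < φ x} ∪ {x | s < (-φ) x} := by
    ext x; simp [lt_abs]
  rw [hunion]
  refine (measureReal_union_le _ _).trans ?_
  linarith

theorem IsTestFun.setIntegral_abs_lapl {n : ℕ} {Ω : Set (Euc n)} {φ : Euc n → ℝ}
    (hφ : IsTestFun n Ω φ) : ∫ x in Ω, |lapl n φ x| = ∫ x, |lapl n φ x| :=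
  setIntegral_eq_integral_of_forall_compl_eq_zero fun x hx => by
    rw [lapl_eq_zero_of_notMem_tsupport fun h => hx (hφ.2.2 h), abs_zero]

theorem IsTestFun.integrable_lapl {n : ℕ} {Ω : Set (Euc n)} {φ : Euc n → ℝ}
    (hφ : IsTestFun n Ω φ) : Integrable (lapl n φ) :=
  (continuous_lapl (contDiff_infty.1 hφ.1 2)).integrable_of_hasCompactSupport
    (hasCompactSupport_lapl hφ.2.1)

theorem decRearr_le {n : ℕ} {Ω : Set (Euc n)} {u : Euc n → ℝ} {s t : ℝ} (hs : 0 ≤ s)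
    (h : volume {x ∈ Ω | s < |u x|} ≤ ENNReal.ofReal t) : decRearr n Ω u t ≤ s :=
  csInf_le ⟨0, fun _ hr => hr.1⟩ ⟨hs, h⟩

theorem decRearr_le_mul_one_add_log {Ω : Set (Euc 2)} (hΩo : IsOpen Ω) (hΩ : volume Ω ≠ ∞)
    {u f : Euc 2 → ℝ} (huf : MemW21Delta0 2 Ω u f) {A : ℝ}
    (hA : L1norm 2 Ω f < 8 * Real.pi * A) {t : ℝ} (ht : 0 < t) (htΩ : t ≤ (volume Ω).toReal) :
    decRearr 2 Ω u t ≤ A * (1 + Real.log ((volume Ω).toReal / t)) := by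
  obtain ⟨hu, hf, φ, hφ, hφu, hφf⟩ := huf
  set V := (volume Ω).toReal with hV
  have hV0 : 0 < V := ht.trans_le htΩ
  have hN0 : 0 ≤ L1norm 2 Ω f := integral_nonneg fun x => abs_nonneg _
  have hA0 : 0 < A := pos_of_mul_pos_right (hN0.trans_lt hA) (by positivity)
  have hlog : 0 ≤ Real.log (V / t) := Real.log_nonneg (by rwa [one_le_div ht])
  set s := A * (1 + Real.log (V / t)) with hs
  have hsA : A ≤ s := le_mul_of_one_le_right hA0.le (by linarith)
  have hNk : ∀ᶠ k in atTop, ∫ x, |lapl 2 (φ k) x| ≤ 8 * Real.pi * A := by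
    have h1 : ∀ᶠ k in atTop, ∫ x in Ω, |lapl 2 (φ k) x - f x| < 8 * Real.pi * A - L1norm 2 Ω f :=
      hφf.eventually_lt_const (by linarith)
    filter_upwards [h1] with k hk
    have hLi : IntegrableOn (lapl 2 (φ k)) Ω := (hφ k).integrable_lapl.integrableOn
    rw [← (hφ k).setIntegral_abs_lapl]
    have h2 : ∫ x in Ω, |lapl 2 (φ k) x| ≤ ∫ x in Ω, (|lapl 2 (φ k) x - f x| + |f x|) := by
      refine integral_mono hLi.abs ((hLi.sub hf).abs.add hf.abs) fun x => ?_
      simpa using abs_add_le (lapl 2 (φ k) x - f x) (f x)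
    have h3 : IntegrableOn (fun x => |lapl 2 (φ k) x - f x|) Ω := (hLi.sub hf).abs
    rw [integral_add h3 hf.abs] at h2
    unfold L1norm at hk
    linarith
  have hρ : 2 * Real.exp (-(3 / 4)) < 1 := by
    have : (2 : ℝ) < Real.exp (3 / 4) := by
      rw [← Real.log_lt_iff_lt_exp two_pos]
      linarith [Real.log_two_lt_d9]
    rw [Real.exp_neg, ← div_eq_mul_inv, div_lt_one (Real.exp_pos _)]
    exact this
  have hclose : ∀ᶠ k in atTop, ∫ x in Ω, |φ k x - u x| <
      A / 4 * ((1 - 2 * Real.exp (-(3 / 4))) * t) :=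
    hφu.eventually_lt_const (by have := sub_pos.2 hρ; positivity)
  obtain ⟨k, hk1, hk2⟩ := (hNk.and hclose).exists
  have hfin : volume {x | s - A / 4 < |φ k x|} ≠ ∞ := by
    refine ((measure_mono fun x (hx : s - A / 4 < |φ k x|) => ?_).trans_lt
      (hφ k).2.1.isCompact.measure_lt_top).ne
    exact subset_tsupport _ (Function.mem_support.2 (abs_pos.1 (lt_trans (by linarith) hx)))
  have hmain : volume.real {x | s - A / 4 < |φ k x|} ≤ 2 * Real.exp (-(3 / 4)) * t := by
    refine (measure_abs_superlevel_le_exp (hφ k) hΩ hA0 hk1 (by linarith)).trans_eq ?_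
    have h1 : -((s - A / 4) / A) = -(3 / 4) - Real.log (V / t) := by
      rw [hs]; field_simp; ring
    rw [h1, Real.exp_sub, Real.exp_log (by positivity), measureReal_def, ← hV]
    field_simp
  have hMarkov : volume ({x | A / 4 ≤ |φ k x - u x|} ∩ Ω) ≤
      ENNReal.ofReal ((1 - 2 * Real.exp (-(3 / 4))) * t) := by
    have hInt : IntegrableOn (fun x => |φ k x - u x|) Ω :=
      (((hφ k).1.continuous.integrable_of_hasCompactSupport (hφ k).2.1).integrableOn.sub hu).abs
    have h1 := mul_meas_ge_le_integral_of_nonneg (μ := volume.restrict Ω)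
      (.of_forall fun x => abs_nonneg (φ k x - u x)) hInt (A / 4)
    rw [measureReal_def, Measure.restrict_apply' hΩo.measurableSet] at h1
    have hne : volume ({x | A / 4 ≤ |φ k x - u x|} ∩ Ω) ≠ ∞ :=
      ne_top_of_le_ne_top hΩ (measure_mono inter_subset_right)
    rw [ENNReal.le_ofReal_iff_toReal_le hne (by have := sub_pos.2 hρ; positivity)]
    exact le_of_mul_le_mul_left (h1.trans hk2.le) (by positivity)
  refine decRearr_le (hA0.le.trans hsA) ?_
  have hsub : {x ∈ Ω | s < |u x|} ⊆
      {x | s - A / 4 < |φ k x|} ∪ ({x | A / 4 ≤ |φ k x - u x|} ∩ Ω) := by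
    rintro x ⟨hxΩ, hx⟩
    by_cases h : A / 4 ≤ |φ k x - u x|
    · exact Or.inr ⟨h, hxΩ⟩
    · left
      have := abs_sub_abs_le_abs_sub (u x) (φ k x)
      rw [abs_sub_comm] at this
      change s - A / 4 < |φ k x|
      linarith
  calc volume {x ∈ Ω | s < |u x|} ≤ _ := measure_mono hsub
    _ ≤ _ := measure_union_le _ _
    _ ≤ ENNReal.ofReal (2 * Real.exp (-(3 / 4)) * t) +
        ENNReal.ofReal ((1 - 2 * Real.exp (-(3 / 4))) * t) := by
        gcongr
        rw [← ENNReal.ofReal_toReal hfin]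
        exact ENNReal.ofReal_le_ofReal hmain
    _ = ENNReal.ofReal t := by
        rw [← ENNReal.ofReal_add (by positivity) (by have := sub_pos.2 hρ; positivity)]
        congr 1; ring

theorem decRearr_div_le {Ω : Set (Euc 2)} (hΩo : IsOpen Ω) (hΩ : volume Ω ≠ ∞)
    {u f : Euc 2 → ℝ} (huf : MemW21Delta0 2 Ω u f) {t : ℝ} (ht : 0 < t)
    (htΩ : t ≤ (volume Ω).toReal) :
    decRearr 2 Ω u t / (1 + Real.log ((volume Ω).toReal / t)) ≤
      1 / (8 * Real.pi) * L1norm 2 Ω f := by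
  have hlog : 0 ≤ Real.log ((volume Ω).toReal / t) := Real.log_nonneg (by rwa [one_le_div ht])
  refine le_of_forall_gt_imp_ge_of_dense fun A hA => ?_
  rw [div_le_iff₀ (by linarith)]
  refine decRearr_le_mul_one_add_log hΩo hΩ huf ?_ ht htΩ
  rwa [one_div, inv_mul_eq_div, div_lt_iff₀' (by positivity)] at hA

theorem LexpNorm_le {Ω : Set (Euc 2)} (hΩo : IsOpen Ω) (hΩ : volume Ω ≠ ∞)
    {u f : Euc 2 → ℝ} (huf : MemW21Delta0 2 Ω u f) :
    LexpNorm Ω u ≤ 1 / (8 * Real.pi) * L1norm 2 Ω f := by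
  refine Real.sSup_le ?_ (mul_nonneg (by positivity) (integral_nonneg fun x => abs_nonneg _))
  rintro r ⟨t, ht, htΩ, rfl⟩
  exact decRearr_div_le hΩo hΩ huf ht htΩ

theorem decRearr_div_le_LexpNorm {Ω : Set (Euc 2)} (hΩo : IsOpen Ω) (hΩ : volume Ω ≠ ∞)
    {u f : Euc 2 → ℝ} (huf : MemW21Delta0 2 Ω u f) {t : ℝ} (ht : 0 < t)
    (htΩ : t ≤ (volume Ω).toReal) :
    decRearr 2 Ω u t / (1 + Real.log ((volume Ω).toReal / t)) ≤ LexpNorm Ω u := by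
  refine le_csSup ⟨1 / (8 * Real.pi) * L1norm 2 Ω f, ?_⟩ ⟨t, ht, htΩ, rfl⟩
  rintro r ⟨t, ht, htΩ, rfl⟩
  exact decRearr_div_le hΩo hΩ huf ht htΩ

theorem lapl_comp_norm_sub_sq {x₀ : Euc 2} {H H₁ H₂ : ℝ → ℝ}
    (hH : ∀ q, 0 ≤ q → HasDerivAt H (H₁ q) q) (hH₁ : ∀ q, 0 ≤ q → HasDerivAt H₁ (H₂ q) q)
    (hC : ContDiff ℝ 2 fun x : Euc 2 => H (‖x - x₀‖ ^ 2)) (x : Euc 2) :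
    lapl 2 (fun x => H (‖x - x₀‖ ^ 2)) x =
      4 * H₁ (‖x - x₀‖ ^ 2) + 4 * ‖x - x₀‖ ^ 2 * H₂ (‖x - x₀‖ ^ 2) := by
  have hq : ∀ x : Euc 2, HasFDerivAt (fun x : Euc 2 => ‖x - x₀‖ ^ 2)
      (2 • (innerSL ℝ (x - x₀))) x := fun x => by
    simpa using ((hasFDerivAt_id x).sub_const x₀).norm_sq
  have h1 : ∀ (x v : Euc 2), fderiv ℝ (fun x => H (‖x - x₀‖ ^ 2)) x v =
      H₁ (‖x - x₀‖ ^ 2) * (2 * inner ℝ (x - x₀) v) := by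
    intro x v
    have := (hH _ (sq_nonneg ‖x - x₀‖)).comp_hasFDerivAt x (hq x)
    rw [show (fun x => H (‖x - x₀‖ ^ 2)) = H ∘ fun x => ‖x - x₀‖ ^ 2 from rfl, this.fderiv]
    simp [inner_sub_left]
  have h2 : ∀ (x v : Euc 2), fderiv ℝ (fun x => H₁ (‖x - x₀‖ ^ 2) * (2 * inner ℝ (x - x₀) v)) x v
      = 2 * H₁ (‖x - x₀‖ ^ 2) * ‖v‖ ^ 2 + 4 * H₂ (‖x - x₀‖ ^ 2) * inner ℝ (x - x₀) v ^ 2 := by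
    intro x v
    have h3 := (hH₁ _ (sq_nonneg ‖x - x₀‖)).comp_hasFDerivAt x (hq x)
    have h4 : HasFDerivAt (fun x : Euc 2 => 2 * inner ℝ (x - x₀) v)
        ((2 : ℝ) • innerSL ℝ v) x := by
      have := ((innerSL ℝ v).hasFDerivAt (x := x - x₀)).comp x ((hasFDerivAt_id x).sub_const x₀)
      refine (this.const_mul 2).congr_of_eventuallyEq (.of_forall fun y => ?_)
      simp [real_inner_comm]
    have h5 := h3.mul h4
    have h6 : (fun x => H₁ (‖x - x₀‖ ^ 2) * (2 * inner ℝ (x - x₀) v)) =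
      (H₁ ∘ fun x => ‖x - x₀‖ ^ 2) * fun x : Euc 2 => 2 * inner ℝ (x - x₀) v := rfl
    rw [h6, h5.fderiv]
    simp [inner_sub_left]
    ring
  rw [lapl_eq_sum_fderiv hC]
  simp only [h1, h2]
  have h7 : ‖x - x₀‖ ^ 2 = (x - x₀) 0 ^ 2 + (x - x₀) 1 ^ 2 := by
    simp [EuclideanSpace.norm_sq_eq, Fin.sum_univ_two]
  generalize H₁ (‖x - x₀‖ ^ 2) = a
  generalize H₂ (‖x - x₀‖ ^ 2) = b
  rw [h7]
  simp [Fin.sum_univ_two, EuclideanSpace.inner_single_right]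
  ring

theorem exists_smooth_convex_ramp :
    ∃ Q : ℝ → ℝ, ContDiff ℝ (⊤ : ℕ∞) Q ∧ (∀ w, w ≤ 0 → Q w = 0) ∧
      (∀ w, w - 1 ≤ Q w) ∧ (∀ w, deriv Q w ≤ 1) ∧ (∀ w, 0 ≤ deriv (deriv Q) w) := by
  have hc : Continuous Real.smoothTransition := Real.smoothTransition.continuous
  have hi : ∀ a b, IntervalIntegrable Real.smoothTransition volume a b := fun a b =>
    hc.intervalIntegrable a b
  set Q : ℝ → ℝ := fun w => ∫ x in (0 : ℝ)..w, Real.smoothTransition x with hQ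
  have hd : ∀ w, HasDerivAt Q (Real.smoothTransition w) w := fun w =>
    intervalIntegral.integral_hasDerivAt_right (hi _ _)
      (hc.stronglyMeasurableAtFilter _ _) hc.continuousAt
  have hderiv : deriv Q = Real.smoothTransition := funext fun w => (hd w).deriv
  have hzero : ∀ w, w ≤ 0 → Q w = 0 := fun w hw => by
    rw [hQ]
    beta_reduce
    rw [intervalIntegral.integral_symm, intervalIntegral.integral_congr (g := fun _ => 0)]
    · simp
    · intro x hx
      rw [uIcc_of_le hw] at hx
      exact Real.smoothTransition.zero_of_nonpos hx.2
  have hmono : Monotone Q := monotone_of_deriv_nonneg (fun w => (hd w).differentiableAt)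
    fun w => by rw [hderiv]; exact Real.smoothTransition.nonneg w
  refine ⟨Q, ?_, hzero, fun w => ?_, fun w => ?_, fun w => ?_⟩
  · rw [contDiff_infty_iff_deriv, hderiv]
    exact ⟨fun w => (hd w).differentiableAt, Real.smoothTransition.contDiff⟩
  · rcases le_total w 1 with h | h
    · have h1 := hmono (min_le_left w 0)
      rw [hzero _ (min_le_right w 0)] at h1
      linarith
    · have h1 : Q w - Q 1 = ∫ x in (1 : ℝ)..w, Real.smoothTransition x :=
        intervalIntegral.integral_interval_sub_left (hi _ _) (hi _ _)
      rw [intervalIntegral.integral_congr (g := fun _ => 1)] at h1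
      · have h2 := hmono zero_le_one
        rw [hzero 0 le_rfl] at h2
        simp at h1
        linarith
      · intro x hx
        rw [uIcc_of_le h] at hx
        exact Real.smoothTransition.one_of_one_le hx.1
  · rw [hderiv]; exact Real.smoothTransition.le_one w
  · rw [hderiv]
    exact Real.smoothTransition.monotone.deriv_nonneg

theorem integral_four_mul_sq_div_sq {ε : ℝ} (hε : 0 < ε) (x₀ : Euc 2) :
    Integrable (fun x : Euc 2 => 4 * ε ^ 2 / (‖x - x₀‖ ^ 2 + ε ^ 2) ^ 2) ∧
    ∫ x : Euc 2, 4 * ε ^ 2 / (‖x - x₀‖ ^ 2 + ε ^ 2) ^ 2 = 4 * Real.pi := by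
  have hpos : ∀ r : ℝ, 0 < r ^ 2 + ε ^ 2 := fun r => by positivity
  have hd : ∀ r ∈ Ici (0 : ℝ), HasDerivAt (fun r => -(2 * ε ^ 2 / (r ^ 2 + ε ^ 2)))
      (r * (4 * ε ^ 2 / (r ^ 2 + ε ^ 2) ^ 2)) r := by
    intro r _
    refine HasDerivAt.congr_deriv ((hasDerivAt_const r (2 * ε ^ 2)).div
      (((hasDerivAt_id r).pow 2).add_const (ε ^ 2)) (hpos r).ne').neg ?_
    simp
    ring
  have hlim : Tendsto (fun r : ℝ => -(2 * ε ^ 2 / (r ^ 2 + ε ^ 2))) atTop (𝓝 0) := by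
    rw [← neg_zero]
    exact (tendsto_const_nhds.div_atTop
      (tendsto_atTop_add_const_right _ _ (tendsto_pow_atTop two_ne_zero))).neg
  have hnn : ∀ r ∈ Ioi (0 : ℝ), 0 ≤ r * (4 * ε ^ 2 / (r ^ 2 + ε ^ 2) ^ 2) := fun r hr =>
    mul_nonneg (le_of_lt hr) (by positivity)
  have hrad : IntegrableOn (fun r : ℝ => r * (4 * ε ^ 2 / (r ^ 2 + ε ^ 2) ^ 2)) (Ioi 0) :=
    integrableOn_Ioi_deriv_of_nonneg' hd hnn hlim
  have hInt : Integrable (fun x : Euc 2 => 4 * ε ^ 2 / (‖x‖ ^ 2 + ε ^ 2) ^ 2) := by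
    rw [integrable_fun_norm_addHaar volume (E := Euc 2)
      (f := fun r => 4 * ε ^ 2 / (r ^ 2 + ε ^ 2) ^ 2)]
    simpa using hrad
  refine ⟨hInt.comp_sub_right x₀, ?_⟩
  rw [integral_sub_right_eq_self (fun x : Euc 2 => 4 * ε ^ 2 / (‖x‖ ^ 2 + ε ^ 2) ^ 2) x₀,
    integral_fun_norm_addHaar volume (fun r => 4 * ε ^ 2 / (r ^ 2 + ε ^ 2) ^ 2)]
  have h2 : volume.real (ball (0 : Euc 2) 1) = Real.pi := by
    rw [measureReal_def, EuclideanSpace.volume_ball_fin_two]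
    simp [Real.pi_pos.le]
  have h3 := integral_Ioi_of_hasDerivAt_of_nonneg' hd hnn hlim
  simp only [finrank_euclideanSpace, Fintype.card_fin, h2, smul_eq_mul, nsmul_eq_mul,
    Nat.add_one_sub_one, pow_one, h3]
  have := hε.ne'
  norm_num
  field_simp
  norm_num

theorem exists_isTestFun_log {Ω : Set (Euc 2)} {x₀ : Euc 2} {r ε : ℝ} (hr : 0 < r) (hε : 0 < ε)
    (hball : closedBall x₀ r ⊆ Ω) :
    ∃ φ : Euc 2 → ℝ, IsTestFun 2 Ω φ ∧ ∫ x, |lapl 2 φ x| ≤ 4 * Real.pi ∧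
      ∀ x ∈ ball x₀ ε, Real.log (r / ε) - 2 ≤ φ x := by
  obtain ⟨Q, hQ, hQ0, hQ1, hQ'1, hQ''⟩ := exists_smooth_convex_ramp
  have hQ2 : ContDiff ℝ (⊤ : ℕ∞) (deriv Q) := (contDiff_infty_iff_deriv.1 hQ).2
  have hdQ : ∀ w, HasDerivAt Q (deriv Q w) w := fun w =>
    ((contDiff_infty_iff_deriv.1 hQ).1 w).hasDerivAt
  have hdQ2 : ∀ w, HasDerivAt (deriv Q) (deriv (deriv Q) w) w := fun w =>
    ((contDiff_infty_iff_deriv.1 hQ2).1 w).hasDerivAt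
  set W : ℝ → ℝ := fun q => Real.log r - 1 / 2 * Real.log (q + ε ^ 2) with hW
  have hdW : ∀ q, 0 ≤ q → HasDerivAt W (-(1 / (2 * (q + ε ^ 2)))) q := fun q hq => by
    have h0 : q + ε ^ 2 ≠ 0 := by positivity
    refine HasDerivAt.congr_deriv
      (((((hasDerivAt_id q).add_const (ε ^ 2)).log h0).const_mul (1 / 2)).const_sub _) ?_
    simp
    ring
  set φ : Euc 2 → ℝ := fun x => Q (W (‖x - x₀‖ ^ 2)) with hφ
  have hsmooth : ContDiff ℝ (⊤ : ℕ∞) φ := by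
    have h1 : ContDiff ℝ (⊤ : ℕ∞) fun x : Euc 2 => ‖x - x₀‖ ^ 2 + ε ^ 2 :=
      ((contDiff_id.sub contDiff_const).norm_sq ℝ).add contDiff_const
    exact hQ.comp (contDiff_const.sub (contDiff_const.mul (h1.log fun x => by positivity)))
  have hzero : ∀ x, x ∉ closedBall x₀ r → φ x = 0 := fun x hx => by
    refine hQ0 _ ?_
    rw [mem_closedBall, dist_eq_norm, not_le] at hx
    have h1 : Real.log (r ^ 2) ≤ Real.log (‖x - x₀‖ ^ 2 + ε ^ 2) := by
      refine Real.log_le_log (by positivity) ?_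
      nlinarith [sq_nonneg ε]
    rw [Real.log_pow] at h1
    push_cast at h1
    simp only [hW]
    linarith
  have htest : IsTestFun 2 Ω φ := by
    refine ⟨hsmooth, HasCompactSupport.intro (isCompact_closedBall x₀ r) hzero, ?_⟩
    refine (closure_minimal (fun x hx => ?_) isClosed_closedBall).trans hball
    by_contra h
    exact hx (hzero x h)
  refine ⟨φ, htest, ?_, fun x hx => ?_⟩
  · set H₁ : ℝ → ℝ := fun q => deriv Q (W q) * -(1 / (2 * (q + ε ^ 2))) with hH₁
    set H₂ : ℝ → ℝ := fun q => deriv (deriv Q) (W q) * (1 / (4 * (q + ε ^ 2) ^ 2)) +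
      deriv Q (W q) * (1 / (2 * (q + ε ^ 2) ^ 2)) with hH₂
    have hd1 : ∀ q, 0 ≤ q → HasDerivAt (Q ∘ W) (H₁ q) q := fun q hq => (hdQ _).comp q (hdW q hq)
    have hd2 : ∀ q, 0 ≤ q → HasDerivAt H₁ (H₂ q) q := fun q hq => by
      have h0 : q + ε ^ 2 ≠ 0 := by positivity
      have h1 : HasDerivAt (fun q => -(1 / (2 * (q + ε ^ 2)))) (1 / (2 * (q + ε ^ 2) ^ 2)) q := by
        refine HasDerivAt.congr_deriv ((hasDerivAt_const q (1 : ℝ)).div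
          (((hasDerivAt_id q).add_const (ε ^ 2)).const_mul 2) (by positivity)).neg ?_
        simp
        field_simp
      refine (((hdQ2 _).comp q (hdW q hq)).mul h1).congr_deriv ?_
      simp only [hH₂, Function.comp]
      field_simp
      ring
    have hlapl : ∀ x, |lapl 2 φ x| ≤ lapl 2 φ x + 4 * ε ^ 2 / (‖x - x₀‖ ^ 2 + ε ^ 2) ^ 2 := by
      intro x
      have h1 : lapl 2 φ x = _ :=
        lapl_comp_norm_sub_sq hd1 hd2 (contDiff_infty.1 hsmooth 2) x
      have hq := sq_nonneg ‖x - x₀‖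
      set q := ‖x - x₀‖ ^ 2
      have h2 : lapl 2 φ x = q * deriv (deriv Q) (W q) / (q + ε ^ 2) ^ 2 -
          deriv Q (W q) * (2 * ε ^ 2 / (q + ε ^ 2) ^ 2) := by
        rw [h1]
        simp only [hH₁, hH₂]
        have h0 : q + ε ^ 2 ≠ 0 := by positivity
        field_simp
        ring
      have h3 : 0 ≤ q * deriv (deriv Q) (W q) / (q + ε ^ 2) ^ 2 :=
        div_nonneg (mul_nonneg hq (hQ'' _)) (by positivity)
      have h4 : deriv Q (W q) * (2 * ε ^ 2 / (q + ε ^ 2) ^ 2) ≤ 2 * ε ^ 2 / (q + ε ^ 2) ^ 2 :=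
        mul_le_of_le_one_left (by positivity) (hQ'1 _)
      have h5 : 4 * ε ^ 2 / (q + ε ^ 2) ^ 2 = 2 * (2 * ε ^ 2 / (q + ε ^ 2) ^ 2) := by ring
      have h6 : 0 ≤ 2 * ε ^ 2 / (q + ε ^ 2) ^ 2 := by positivity
      rw [h5, abs_le]
      constructor <;> linarith
    obtain ⟨hki, hk⟩ := integral_four_mul_sq_div_sq hε x₀
    have hInt := htest.integrable_lapl
    have hzero : ∫ x, lapl 2 φ x = 0 := by
      have := integral_deriv_comp_mul_norm_fderiv_sq (contDiff_infty.1 hsmooth 2) htest.2.1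
        (contDiff_const (c := (1 : ℝ)))
      simpa using this
    calc ∫ x, |lapl 2 φ x| ≤
        ∫ x, (lapl 2 φ x + 4 * ε ^ 2 / (‖x - x₀‖ ^ 2 + ε ^ 2) ^ 2) :=
          integral_mono hInt.abs (hInt.add hki) hlapl
      _ = 4 * Real.pi := by rw [integral_add hInt hki, hzero, hk, zero_add]
  · refine le_trans ?_ (hQ1 _)
    rw [mem_ball, dist_eq_norm] at hx
    have h1 : Real.log (‖x - x₀‖ ^ 2 + ε ^ 2) ≤ Real.log (2 * ε ^ 2) := by
      refine Real.log_le_log (by positivity) ?_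
      nlinarith [norm_nonneg (x - x₀)]
    rw [Real.log_mul two_ne_zero (by positivity), Real.log_pow] at h1
    rw [Real.log_div hr.ne' hε.ne']
    have := Real.log_two_lt_d9
    push_cast at h1
    simp only [hW]
    linarith

theorem le_decRearr {n : ℕ} {Ω B : Set (Euc n)} {u : Euc n → ℝ} {m t : ℝ} (hB : B ⊆ Ω)
    (hm : ∀ x ∈ B, m ≤ u x) (ht : ENNReal.ofReal t < volume B) (hu : ∃ M, ∀ x, |u x| ≤ M) :
    m ≤ decRearr n Ω u t := by
  obtain ⟨M, hM⟩ := hu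
  refine le_csInf ⟨|M|, abs_nonneg M, ?_⟩ fun s hs => ?_
  · have : {x ∈ Ω | |M| < |u x|} = ∅ :=
      eq_empty_of_forall_notMem fun x hx => hx.2.not_ge ((hM x).trans (le_abs_self M))
    simp [this]
  · by_contra! h
    refine (ht.trans_le (measure_mono fun x hx => ?_)).not_ge hs.2
    exact ⟨hB hx, h.trans_le ((hm x hx).trans (le_abs_self _))⟩

theorem IsTestFun.memW21Delta0 {n : ℕ} {Ω : Set (Euc n)} {φ : Euc n → ℝ}
    (hφ : IsTestFun n Ω φ) : MemW21Delta0 n Ω φ (lapl n φ) :=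
  ⟨(hφ.1.continuous.integrable_of_hasCompactSupport hφ.2.1).integrableOn,
    hφ.integrable_lapl.integrableOn, fun _ => φ, fun _ => hφ, by simp, by simp⟩

theorem log_div_sub_two_le {Ω : Set (Euc 2)} (hΩo : IsOpen Ω) (hΩ : volume Ω ≠ ∞) {c : ℝ}
    (hc : ∀ u f : Euc 2 → ℝ, MemW21Delta0 2 Ω u f → LexpNorm Ω u ≤ c * L1norm 2 Ω f)
    {x₀ : Euc 2} {r ε : ℝ} (hε : 0 < ε) (hεr : ε ≤ r) (hball : closedBall x₀ r ⊆ Ω) :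
    Real.log (r / ε) - 2 ≤ max c 0 * (4 * Real.pi) *
      (1 + Real.log ((volume Ω).toReal / (Real.pi * ε ^ 2 / 2))) := by
  obtain ⟨φ, hφ, hN, hφε⟩ := exists_isTestFun_log (hε.trans_le hεr) hε hball
  have hεΩ : ball x₀ ε ⊆ Ω :=
    (ball_subset_closedBall.trans (closedBall_subset_closedBall hεr)).trans hball
  set t := Real.pi * ε ^ 2 / 2 with ht
  have ht0 : 0 < t := by positivity
  have hvol : volume (ball x₀ ε) = ENNReal.ofReal (Real.pi * ε ^ 2) := by
    rw [EuclideanSpace.volume_ball_fin_two, ← ENNReal.ofReal_pow hε.le,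
      ENNReal.ofReal_mul Real.pi_pos.le, mul_comm]
  have htB : ENNReal.ofReal t < volume (ball x₀ ε) := by
    rw [hvol]
    exact (ENNReal.ofReal_lt_ofReal_iff (by positivity)).2 (half_lt_self (by positivity))
  have htΩ : t ≤ (volume Ω).toReal :=
    (ENNReal.ofReal_le_iff_le_toReal hΩ).1 (htB.le.trans (measure_mono hεΩ))
  have hlog : 0 ≤ Real.log ((volume Ω).toReal / t) := Real.log_nonneg (by rwa [one_le_div ht0])
  have hbdd : ∃ M, ∀ x, |φ x| ≤ M := hφ.1.continuous.bounded_above_of_compact_support hφ.2.1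
  have hle : decRearr 2 Ω φ t / (1 + Real.log ((volume Ω).toReal / t)) ≤
      max c 0 * (4 * Real.pi) := by
    refine (decRearr_div_le_LexpNorm hΩo hΩ hφ.memW21Delta0 ht0 htΩ).trans
      ((hc _ _ hφ.memW21Delta0).trans ?_)
    rw [L1norm, hφ.setIntegral_abs_lapl]
    gcongr
    exact le_max_left c 0
  rw [div_le_iff₀ (by linarith)] at hle
  exact (le_decRearr hεΩ hφε htB hbdd).trans hle

theorem one_div_eight_pi_le {Ω : Set (Euc 2)} (hΩo : IsOpen Ω) (hΩ : volume Ω ≠ ∞)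
    (hΩne : Ω.Nonempty) {c : ℝ}
    (hc : ∀ u f : Euc 2 → ℝ, MemW21Delta0 2 Ω u f → LexpNorm Ω u ≤ c * L1norm 2 Ω f) :
    1 / (8 * Real.pi) ≤ c := by
  obtain ⟨x₀, hx₀⟩ := hΩne
  obtain ⟨r, hr, hball⟩ := nhds_basis_closedBall.mem_iff.1 (hΩo.mem_nhds hx₀)
  have hV : 0 < (volume Ω).toReal :=
    ENNReal.toReal_pos (hΩo.measure_pos volume ⟨x₀, hx₀⟩).ne' hΩ
  have hlin : ∀ L, 0 ≤ L → L * (1 - 8 * Real.pi * max c 0) ≤ 2 + max c 0 * (4 * Real.pi) *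
      (1 + Real.log ((volume Ω).toReal / (Real.pi * r ^ 2 / 2))) := by
    intro L hL
    have hexp : 0 < Real.exp (-L) := Real.exp_pos _
    have h1 := log_div_sub_two_le hΩo hΩ hc (ε := r * Real.exp (-L)) (by positivity)
      (mul_le_of_le_one_right hr.le (Real.exp_le_one_iff.2 (by linarith))) hball
    have h2 : r / (r * Real.exp (-L)) = Real.exp L := by
      rw [Real.exp_neg]; field_simp
    have h3 : (volume Ω).toReal / (Real.pi * (r * Real.exp (-L)) ^ 2 / 2) =
        (volume Ω).toReal / (Real.pi * r ^ 2 / 2) * Real.exp L ^ 2 := by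
      rw [Real.exp_neg]; field_simp
    rw [h2, h3, Real.log_mul (by positivity) (by positivity), Real.log_pow, Real.log_exp] at h1
    push_cast at h1
    linarith
  have hmax : 1 / (8 * Real.pi) ≤ max c 0 := by
    by_contra! h
    rw [lt_div_iff₀ (by positivity)] at h
    have hpos : 0 < 1 - 8 * Real.pi * max c 0 := by linarith
    set K := 2 + max c 0 * (4 * Real.pi) *
      (1 + Real.log ((volume Ω).toReal / (Real.pi * r ^ 2 / 2)))
    have h1 := hlin ((|K| + 1) / (1 - 8 * Real.pi * max c 0)) (by positivity)
    rw [div_mul_cancel₀ _ hpos.ne'] at h1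
    linarith [le_abs_self K]
  exact (le_max_iff.1 hmax).resolve_right (not_le.2 (by positivity))

end

/-- For Ω ⊆ ℝ² open and bounded (nonempty), every u ∈ W^{2,1}_{Δ,0}(Ω)
satisfies ‖u‖*_{Lexp} ≤ (1/(8π)) ‖Δu‖₁, and the constant 1/(8π) is sharp. -/
theorem stmt_10 (Ω : Set (Euc 2)) (hΩo : IsOpen Ω) (hΩb : Bornology.IsBounded Ω)
    (hΩne : Ω.Nonempty) :
    (∀ u f : Euc 2 → ℝ, MemW21Delta0 2 Ω u f →
      LexpNorm Ω u ≤ (1 / (8 * Real.pi)) * L1norm 2 Ω f) ∧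
    (∀ c : ℝ, (∀ u f : Euc 2 → ℝ, MemW21Delta0 2 Ω u f →
        LexpNorm Ω u ≤ c * L1norm 2 Ω f) →
      1 / (8 * Real.pi) ≤ c) := by
  have hΩ : volume Ω ≠ ∞ := hΩb.measure_lt_top.ne
  exact ⟨fun u f huf => LexpNorm_le hΩo hΩ huf,
    fun c hc => one_div_eight_pi_le hΩo hΩ hΩne hc⟩
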